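/- Let ω be a 3-form on a 6-dimensional real vector space V with volume form θ and Hitchin pfaffian λ(ω) > 0. Then ω = α + β where α and β are real decomposable 3-forms; moreover, if one requires (α ∧ β)/θ > 0, this decomposition is unique and given by 2α = ω + |λ(ω)|^{-3/2} K_ω*(ω) and 2β = ω − |λ(ω)|^{-3/2} K_ω*(ω). -/

import Mathlib

/- Framework: exterior forms on a real vector space `V` are modelled as elements of the
exterior algebra of the dual space; a `k`-form is an element of the submodule
`⋀[ℝ]^k (Module.Dual ℝ V)`, and the wedge product is the algebra multiplication. -/

noncomputable section
open ExteriorAlgebra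
set_option synthInstance.maxHeartbeats 1000000
set_option maxHeartbeats 1000000

variable (V : Type) [AddCommGroup V] [Module ℝ V]

/-- The algebra of exterior forms on `V`. -/
abbrev EForm := ExteriorAlgebra ℝ (Module.Dual ℝ V)

variable {V}

/-- Interior product (contraction) of forms by a vector, linear in the vector. -/
def iContrL : V →ₗ[ℝ] Module.End ℝ (EForm V) :=
  (CliffordAlgebra.contractLeft (Q := (0 : QuadraticForm ℝ (Module.Dual ℝ V)))).comp
    (Module.Dual.eval ℝ V)

/-- Contraction of forms by an arbitrary element of the exterior algebra of `V`
(e.g. by a bivector), extending `iContrL` as an algebra morphism. -/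
def aContr : ExteriorAlgebra ℝ V →ₐ[ℝ] Module.End ℝ (EForm V) :=
  ExteriorAlgebra.lift ℝ ⟨iContrL, fun _ =>
    LinearMap.ext fun _ => CliffordAlgebra.contractLeft_contractLeft _ _⟩

/-- The bilinear form on `V` associated with an exterior 2-form, via double contraction
(the scalar part is extracted by `ExteriorAlgebra.algebraMapInv`). -/
def formToBilin (Om : EForm V) : V →ₗ[ℝ] V →ₗ[ℝ] ℝ :=
  LinearMap.mk₂ ℝ (fun x y => algebraMapInv (iContrL y (iContrL x Om)))
    (fun x x' y => by simp [map_add, LinearMap.add_apply])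
    (fun c x y => by simp [map_smul, LinearMap.smul_apply])
    (fun x y y' => by simp [map_add, LinearMap.add_apply])
    (fun c x y => by simp [map_smul, LinearMap.smul_apply])

/-- A 2-form is nondegenerate (symplectic) if its associated bilinear form is. -/
def IsSymplecticForm (Om : EForm V) : Prop :=
  Om ∈ ⋀[ℝ]^2 (Module.Dual ℝ V) ∧ ∀ x : V, (∀ y : V, formToBilin Om x y = 0) → x = 0

/-- The algebra morphism `⋀ V → ⋀ V*` induced by a linear map `Γ : V → V*`. -/
def extAlgMap (f : V →ₗ[ℝ] Module.Dual ℝ V) : ExteriorAlgebra ℝ V →ₐ[ℝ] EForm V :=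
  ExteriorAlgebra.lift ℝ ⟨(ExteriorAlgebra.ι ℝ).comp f, fun _ => ι_sq_zero _⟩

/-- `XOm` is the bivector dual to the symplectic form `Om`, i.e. the unique bivector with
`Γ^*(X_Ω) = Ω` where `Γ : V → V*` is the isomorphism induced by `Om`. -/
def IsDualBivector (Om : EForm V) (XOm : ExteriorAlgebra ℝ V) : Prop :=
  XOm ∈ ⋀[ℝ]^2 V ∧ extAlgMap (formToBilin Om) XOm = Om

/-- The pullback action on forms induced by an endomorphism `K : V → V`. -/
def formPullback (K : V →ₗ[ℝ] V) : EForm V →ₐ[ℝ] EForm V :=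
  ExteriorAlgebra.lift ℝ ⟨(ExteriorAlgebra.ι ℝ).comp K.dualMap, fun _ => ι_sq_zero _⟩


/-- A real decomposable 3-form: a wedge product of three 1-forms. -/
def IsDecomposable3 (α : EForm V) : Prop :=
  ∃ a b c : Module.Dual ℝ V, α = ExteriorAlgebra.ι ℝ a * ExteriorAlgebra.ι ℝ b *
    ExteriorAlgebra.ι ℝ c

section Contraction

lemma iContrL_ι_mul (X : V) (f : Module.Dual ℝ V) (x : EForm V) :
    iContrL X (ι ℝ f * x) = f X • x - ι ℝ f * iContrL X x :=
  CliffordAlgebra.contractLeft_ι_mul (Q := (0 : QuadraticForm ℝ (Module.Dual ℝ V)))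
    (Module.Dual.eval ℝ V X) f x

lemma iContrL_algebraMap (X : V) (r : ℝ) : iContrL X (algebraMap ℝ (EForm V) r) = 0 :=
  CliffordAlgebra.contractLeft_algebraMap (0 : QuadraticForm ℝ (Module.Dual ℝ V))
    (Module.Dual.eval ℝ V X) r

lemma iContrL_ι (X : V) (f : Module.Dual ℝ V) :
    iContrL X (ι ℝ f) = algebraMap ℝ (EForm V) (f X) :=
  CliffordAlgebra.contractLeft_ι (0 : QuadraticForm ℝ (Module.Dual ℝ V))
    (Module.Dual.eval ℝ V X) f

lemma iContrL_self (X : V) (x : EForm V) : iContrL X (iContrL X x) = 0 :=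
  CliffordAlgebra.contractLeft_contractLeft (Q := (0 : QuadraticForm ℝ (Module.Dual ℝ V)))
    (Module.Dual.eval ℝ V X) x

lemma iContrL_comm (X Y : V) (x : EForm V) :
    iContrL X (iContrL Y x) = -iContrL Y (iContrL X x) :=
  CliffordAlgebra.contractLeft_comm (Q := (0 : QuadraticForm ℝ (Module.Dual ℝ V)))
    (Module.Dual.eval ℝ V X) (Module.Dual.eval ℝ V Y) x

lemma ι_mul_comm_of_mem {k : ℕ} {η : EForm V} (hη : η ∈ ⋀[ℝ]^k (Module.Dual ℝ V))
    (f : Module.Dual ℝ V) : ι ℝ f * η = (-1 : ℝ) ^ k • (η * ι ℝ f) := by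
  induction hη using Submodule.pow_induction_on_left' with
  | algebraMap r => simp [Algebra.commutes]
  | add x y i _ _ hx hy => rw [mul_add, hx, hy, add_mul, smul_add]
  | mem_mul m hm i x _ hx =>
    obtain ⟨g, rfl⟩ := hm
    have h : ι ℝ f * ι ℝ g = -(ι ℝ g * ι ℝ f) :=
      eq_neg_of_add_eq_zero_left (ι_add_mul_swap f g)
    rw [← mul_assoc, h, neg_mul, mul_assoc, hx, mul_smul_comm, pow_succ, mul_neg_one, neg_smul,
      mul_assoc]

lemma mul_comm_of_mem {k l : ℕ} {η ζ : EForm V} (hη : η ∈ ⋀[ℝ]^k (Module.Dual ℝ V))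
    (hζ : ζ ∈ ⋀[ℝ]^l (Module.Dual ℝ V)) : ζ * η = ((-1 : ℝ) ^ k) ^ l • (η * ζ) := by
  induction hζ using Submodule.pow_induction_on_left' with
  | algebraMap r => simp [Algebra.commutes]
  | add x y i _ _ hx hy => rw [add_mul, hx, hy, mul_add, smul_add]
  | mem_mul m hm i x _ hx =>
    obtain ⟨g, rfl⟩ := hm
    rw [mul_assoc, hx, mul_smul_comm, ← mul_assoc, ι_mul_comm_of_mem hη, smul_mul_assoc, smul_smul,
      pow_succ, mul_assoc]

lemma iContrL_mul_of_mem (X : V) {k : ℕ} {η : EForm V} (hη : η ∈ ⋀[ℝ]^k (Module.Dual ℝ V))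
    (ζ : EForm V) :
    iContrL X (η * ζ) = iContrL X η * ζ + (-1 : ℝ) ^ k • (η * iContrL X ζ) := by
  induction hη using Submodule.pow_induction_on_left' with
  | algebraMap r =>
    rw [iContrL_algebraMap, ← Algebra.smul_def, map_smul, ← Algebra.smul_def]
    simp
  | add x y i _ _ hx hy => rw [add_mul, map_add, hx, hy, map_add, add_mul, add_mul, smul_add]; abel
  | mem_mul m hm i x _ hx =>
    obtain ⟨g, rfl⟩ := hm
    rw [mul_assoc, iContrL_ι_mul, hx, iContrL_ι_mul, mul_add, mul_smul_comm, pow_succ, mul_neg_one,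
      neg_smul, sub_mul, smul_mul_assoc, mul_assoc, mul_assoc]
    abel

lemma iContrL_mem (X : V) {k : ℕ} {η : EForm V} (hη : η ∈ ⋀[ℝ]^k (Module.Dual ℝ V)) :
    iContrL X η ∈ ⋀[ℝ]^(k - 1) (Module.Dual ℝ V) := by
  induction hη using Submodule.pow_induction_on_left' with
  | algebraMap r => rw [iContrL_algebraMap]; exact zero_mem _
  | add x y i _ _ hx hy => rw [map_add]; exact add_mem hx hy
  | mem_mul m hm i x hxi hx =>
    obtain ⟨g, rfl⟩ := hm
    rw [iContrL_ι_mul]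
    refine sub_mem (Submodule.smul_mem _ _ hxi) ?_
    obtain _ | i := i
    · rw [pow_zero, Submodule.mem_one] at hxi
      obtain ⟨r, rfl⟩ := hxi
      rw [iContrL_algebraMap, mul_zero]
      exact zero_mem _
    · have := Submodule.mul_mem_mul (LinearMap.mem_range_self (ι ℝ) g) hx
      rw [← pow_succ'] at this
      exact this

/-- Euler's formula: `∑ eⁱ ∧ i_{eᵢ} η = k η` for a `k`-form `η`. -/
lemma sum_ι_coord_mul_iContrL {I : Type*} [Fintype I] (b : Module.Basis I ℝ V) {k : ℕ}
    {η : EForm V} (hη : η ∈ ⋀[ℝ]^k (Module.Dual ℝ V)) :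
    ∑ i, ι ℝ (b.coord i) * iContrL (b i) η = (k : ℝ) • η := by
  induction hη using Submodule.pow_induction_on_left' with
  | algebraMap r => simp [iContrL_algebraMap]
  | add x y i _ _ hx hy => simp only [map_add, mul_add, Finset.sum_add_distrib, hx, hy, smul_add]
  | mem_mul m hm k x _ hx =>
    obtain ⟨g, rfl⟩ := hm
    have hg : ∑ i, g (b i) • ι ℝ (b.coord i) = ι ℝ g := by
      simp only [← map_smul, ← map_sum, b.sum_dual_apply_smul_coord]
    have h (i : I) : ι ℝ (b.coord i) * iContrL (b i) (ι ℝ g * x) =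
        (g (b i) • ι ℝ (b.coord i)) * x + ι ℝ g * (ι ℝ (b.coord i) * iContrL (b i) x) := by
      rw [iContrL_ι_mul, mul_sub, ← mul_assoc, eq_neg_of_add_eq_zero_left (ι_add_mul_swap _ g),
        mul_smul_comm, smul_mul_assoc, neg_mul, sub_neg_eq_add, mul_assoc]
    simp only [h, Finset.sum_add_distrib, ← Finset.sum_mul, ← Finset.mul_sum, hg, hx]
    rw [mul_smul_comm, Nat.succ_eq_add_one, Nat.cast_succ, add_smul, one_smul, add_comm]

end Contraction

section TopForm

lemma ι_mul_eq_zero_of_top [FiniteDimensional ℝ V] {n : ℕ} (hdim : Module.finrank ℝ V = n)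
    {θ : EForm V} (hθ : θ ∈ ⋀[ℝ]^n (Module.Dual ℝ V)) (f : Module.Dual ℝ V) : ι ℝ f * θ = 0 := by
  have h : Module.finrank ℝ (⋀[ℝ]^(n + 1) (Module.Dual ℝ V)) = 0 := by
    rw [exteriorPower.finrank_eq, Subspace.dual_finrank_eq, hdim, Nat.choose_succ_self]
  have := Module.finrank_zero_iff.mp h
  have hmem : ι ℝ f * θ ∈ ⋀[ℝ]^(n + 1) (Module.Dual ℝ V) := by
    have := Submodule.mul_mem_mul (LinearMap.mem_range_self (ι ℝ) f) hθ
    rwa [← pow_succ'] at this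
  exact congrArg Subtype.val (Subsingleton.elim (⟨_, hmem⟩ : ⋀[ℝ]^(n + 1) (Module.Dual ℝ V)) 0)

variable {θ : EForm V} (hθ : ∀ f : Module.Dual ℝ V, ι ℝ f * θ = 0)
include hθ

lemma ι_mul_iContrL_top (f : Module.Dual ℝ V) (X : V) : ι ℝ f * iContrL X θ = f X • θ := by
  have h := iContrL_ι_mul X f θ
  rw [hθ, map_zero] at h
  exact (sub_eq_zero.mp h.symm).symm

lemma eq_zero_of_iContrL_top (hθ0 : θ ≠ 0) {X : V} (hX : iContrL X θ = 0) : X = 0 := by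
  refine (Module.forall_dual_apply_eq_zero_iff ℝ X).mp fun f => ?_
  have h := ι_mul_iContrL_top hθ f X
  rw [hX, mul_zero] at h
  exact (smul_eq_zero.mp h.symm).resolve_right hθ0

lemma smul_eq_smul_of_iContrL_top (hθ0 : θ ≠ 0) {X Y : V}
    (h : iContrL X (iContrL Y θ) = 0) (f : Module.Dual ℝ V) : f X • Y = f Y • X := by
  have h1 := iContrL_ι_mul X f (iContrL Y θ)
  rw [h, mul_zero, sub_zero, ι_mul_iContrL_top hθ, map_smul] at h1
  refine (sub_eq_zero.mp (eq_zero_of_iContrL_top hθ hθ0 ?_)).symm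
  rw [map_sub, map_smul, map_smul, LinearMap.sub_apply, LinearMap.smul_apply, LinearMap.smul_apply,
    h1, sub_self]

end TopForm

section Hitchin

variable {θ ω : EForm V} (hθ : ∀ f : Module.Dual ℝ V, ι ℝ f * θ = 0) (hθ0 : θ ≠ 0)
  (hω : ω ∈ ⋀[ℝ]^3 (Module.Dual ℝ V)) {K : V →ₗ[ℝ] V}
  (hK : ∀ X : V, iContrL X ω * ω = iContrL (K X) θ)
include hθ hθ0 hω hK

lemma iContrL_hitchin_iContrL (X : V) : iContrL (K X) (iContrL X ω) = 0 := by
  have hσ := iContrL_mem X hω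
  obtain ⟨f, hf⟩ : iContrL (K X) (iContrL X ω) ∈ LinearMap.range (ι ℝ) := by
    simpa [exteriorPower] using iContrL_mem (K X) hσ
  by_contra hne
  have hf0 : f ≠ 0 := by rintro rfl; exact hne (by rw [← hf, map_zero])
  have hσσ : iContrL X ω * iContrL X ω = iContrL X (iContrL (K X) θ) := by
    have h := iContrL_mul_of_mem X hσ ω
    rw [hK, iContrL_self, zero_mul, zero_add] at h
    simpa using h.symm
  have hfσ : ι ℝ f * iContrL X ω = 0 := by
    have h := congrArg (iContrL (K X)) hσσ
    rw [iContrL_comm, iContrL_self, iContrL_mul_of_mem _ hσ, ← hf, map_zero, neg_zero,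
      ι_mul_comm_of_mem hσ] at h
    rw [ι_mul_comm_of_mem hσ]
    norm_num at h ⊢
    rw [← two_smul ℝ] at h
    simpa using h
  obtain ⟨Z, hZ⟩ : ∃ Z, f Z ≠ 0 := by
    by_contra! h
    exact hf0 (LinearMap.ext h)
  have hσσ0 : iContrL X ω * iContrL X ω = 0 := by
    have h := iContrL_ι_mul Z f (iContrL X ω)
    rw [hfσ, map_zero] at h
    have h' : f Z • (iContrL X ω * iContrL X ω) = 0 := by
      rw [← mul_smul_comm, sub_eq_zero.mp h.symm, ← mul_assoc]
      have hc := ι_mul_comm_of_mem hσ f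
      rw [hfσ] at hc
      norm_num at hc
      rw [← hc, zero_mul]
    exact (smul_eq_zero.mp h').resolve_left hZ
  rw [hσσ0] at hσσ
  by_cases hX : X = 0
  · simp [hX] at hne
  obtain ⟨g, hg⟩ := Module.Projective.exists_dual_eq_one ℝ hX
  have hpar := smul_eq_smul_of_iContrL_top hθ hθ0 hσσ.symm g
  rw [hg, one_smul] at hpar
  rw [hpar, map_smul, LinearMap.smul_apply, iContrL_self, smul_zero] at hne
  exact hne rfl

lemma iContrL_iContrL_hitchin_sq (X : V) : iContrL X (iContrL (K (K X)) θ) = 0 := by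
  have h0 := iContrL_hitchin_iContrL hθ hθ0 hω hK X
  have h1 : iContrL X ω * iContrL (K X) ω = 0 := by
    have h := iContrL_mul_of_mem (K X) (iContrL_mem X hω) ω
    rw [hK, iContrL_self, h0, zero_mul, zero_add] at h
    simpa using h.symm
  rw [← hK, iContrL_mul_of_mem X (iContrL_mem (K X) hω), iContrL_comm, h0, neg_zero, zero_mul,
    zero_add, mul_comm_of_mem (iContrL_mem X hω) (iContrL_mem (K X) hω), h1, smul_zero, smul_zero]

/-- The Hitchin endomorphism squares to a scalar, namely the pfaffian `λ(ω)`. -/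
lemma exists_hitchin_sq [FiniteDimensional ℝ V] : ∃ c : ℝ, ∀ X, K (K X) = c • X := by
  obtain ⟨c, hc⟩ := LinearMap.exists_eq_smul_id_of_forall_notLinearIndependent
    (f := K ∘ₗ K) fun X => by
      by_cases hX : X = 0
      · exact fun h => h.ne_zero 0 (by simp [hX])
      obtain ⟨g, hg⟩ := Module.Projective.exists_dual_eq_one ℝ hX
      have h := smul_eq_smul_of_iContrL_top hθ hθ0 (iContrL_iContrL_hitchin_sq hθ hθ0 hω hK X) g
      rw [hg, one_smul] at h
      rw [LinearIndependent.pair_iff]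
      push Not
      exact ⟨g (K (K X)), -1, by simp [← h], by simp⟩
  exact ⟨c, fun X => by simpa using LinearMap.congr_fun hc X⟩

lemma trace_hitchin [FiniteDimensional ℝ V] : LinearMap.trace ℝ V K = 0 := by
  let b := Module.finBasis ℝ V
  have hωω : ω * ω = 0 := by
    have h := mul_comm_of_mem hω hω
    norm_num at h
    rw [← add_eq_zero_iff_eq_neg, ← two_smul ℝ] at h
    simpa using h
  have h := congrArg (· * ω) (sum_ι_coord_mul_iContrL b hω)
  simp only [Finset.sum_mul, mul_assoc, hK, ι_mul_iContrL_top hθ, smul_mul_assoc, hωω, smul_zero,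
    ← Finset.sum_smul] at h
  rw [LinearMap.trace_eq_matrix_trace ℝ b, Matrix.trace]
  simpa [LinearMap.toMatrix_apply] using (smul_eq_zero.mp h).resolve_right hθ0

lemma iContrL_iContrL_of_eigen {s : ℝ} (hs : s ≠ 0) {X Y : V} (hX : K X = s • X)
    (hY : K Y = -(s • Y)) : iContrL X (iContrL Y ω) = 0 := by
  have h := iContrL_hitchin_iContrL hθ hθ0 hω hK (X + Y)
  simp only [map_add, hX, hY, map_smul, map_neg, LinearMap.add_apply, LinearMap.smul_apply,
    LinearMap.neg_apply, iContrL_self, smul_zero, zero_add, neg_zero, add_zero] at h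
  rw [iContrL_comm Y X, smul_neg, neg_neg, ← two_smul ℝ, smul_smul] at h
  exact (smul_eq_zero.mp h).resolve_left (by simpa using hs)

end Hitchin

section Eigenbasis

lemma finrank_eigenspace_of_sq [FiniteDimensional ℝ V] {n : ℕ}
    (hdim : Module.finrank ℝ V = 2 * n) {K : V →ₗ[ℝ] V} (htr : LinearMap.trace ℝ V K = 0)
    {t : ℝ} (ht : t ≠ 0) (hKK : ∀ X, K (K X) = t ^ 2 • X) :
    Module.finrank ℝ (Module.End.eigenspace K t) = n := by
  have hproj : LinearMap.IsProj (Module.End.eigenspace K t)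
      ((2⁻¹ : ℝ) • (LinearMap.id + t⁻¹ • K)) := by
    refine ⟨fun X => ?_, fun X hX => ?_⟩
    · rw [Module.End.mem_eigenspace_iff]
      simp only [LinearMap.smul_apply, LinearMap.add_apply, LinearMap.id_apply, map_smul, map_add,
        hKK, smul_add, smul_smul]
      rw [add_comm]
      congr 2 <;> field_simp
    · rw [Module.End.mem_eigenspace_iff] at hX
      simp only [LinearMap.smul_apply, LinearMap.add_apply, LinearMap.id_apply, hX]
      rw [inv_smul_smul₀ ht, ← two_smul ℝ, inv_smul_smul₀ two_ne_zero]
  have h := hproj.trace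
  rw [map_smul, map_add, map_smul, htr, LinearMap.trace_id, hdim] at h
  have h' : (n : ℝ) = Module.finrank ℝ (Module.End.eigenspace K t) := by
    rw [← h]; simp
  exact_mod_cast h'.symm

lemma exists_eigenbasis_of_sq [FiniteDimensional ℝ V] {n : ℕ}
    (hdim : Module.finrank ℝ V = 2 * n) {K : V →ₗ[ℝ] V} (htr : LinearMap.trace ℝ V K = 0)
    {s : ℝ} (hs : s ≠ 0) (hKK : ∀ X, K (K X) = s ^ 2 • X) :
    ∃ b : Module.Basis (Fin n ⊕ Fin n) ℝ V, (∀ i, K (b (.inl i)) = s • b (.inl i)) ∧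
      ∀ j, K (b (.inr j)) = -(s • b (.inr j)) := by
  have hp := finrank_eigenspace_of_sq hdim htr hs hKK
  have hq := finrank_eigenspace_of_sq (t := -s) hdim htr (neg_ne_zero.mpr hs) (by simpa using hKK)
  have hne : s ≠ -s := fun h => hs (self_eq_neg.mp h)
  have hcompl : IsCompl (Module.End.eigenspace K s) (Module.End.eigenspace K (-s)) :=
    (Submodule.isCompl_iff_disjoint _ _ (by rw [hp, hq, hdim]; omega)).mpr
      ((Module.End.eigenspaces_iSupIndep K).pairwiseDisjoint hne)
  let b := ((Module.finBasisOfFinrankEq ℝ _ hp).prod (Module.finBasisOfFinrankEq ℝ _ hq)).map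
    (Submodule.prodEquivOfIsCompl _ _ hcompl)
  refine ⟨b, fun i => ?_, fun j => ?_⟩
  · refine Module.End.mem_eigenspace_iff.mp ?_
    simp [b]
  · rw [← neg_smul]
    refine Module.End.mem_eigenspace_iff.mp ?_
    simp [b]

end Eigenbasis

section Decomposable

lemma ιMulti_three (a : Fin 3 → Module.Dual ℝ V) :
    ιMulti ℝ 3 a = ι ℝ (a 0) * ι ℝ (a 1) * ι ℝ (a 2) := by
  rw [ιMulti_apply, mul_assoc]
  simp only [List.ofFn_succ, List.ofFn_zero, List.prod_cons, List.prod_nil, mul_one]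
  rfl

lemma ι_mul_ι_mul_ι_mem_span (a : Fin 3 → Module.Dual ℝ V) (i j k : Fin 3) :
    ι ℝ (a i) * ι ℝ (a j) * ι ℝ (a k) ∈ Submodule.span ℝ {ιMulti ℝ 3 a} := by
  have h : ι ℝ (a i) * ι ℝ (a j) * ι ℝ (a k) = ιMulti ℝ 3 (a ∘ ![i, j, k]) := by
    rw [ιMulti_three]
    rfl
  rw [h]
  by_cases hinj : Function.Injective ![i, j, k]
  · have hperm := (ιMulti ℝ 3).map_perm a
      (Equiv.ofBijective _ (Finite.injective_iff_bijective.mp hinj))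
    rw [Equiv.coe_ofBijective] at hperm
    rw [hperm]
    rcases Int.units_eq_one_or (Equiv.Perm.sign (Equiv.ofBijective _
      (Finite.injective_iff_bijective.mp hinj))) with h | h <;> rw [h]
    all_goals simp
  · rw [AlternatingMap.map_eq_zero_of_not_injective _ _ fun h => hinj h.of_comp]
    exact zero_mem _

lemma isDecomposable3_of_mem_span {a : Fin 3 → Module.Dual ℝ V} {α : EForm V}
    (h : α ∈ Submodule.span ℝ {ιMulti ℝ 3 a}) : IsDecomposable3 α := by
  obtain ⟨r, rfl⟩ := Submodule.mem_span_singleton.mp h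
  exact ⟨r • a 0, a 1, a 2, by rw [ιMulti_three, map_smul, smul_mul_assoc, smul_mul_assoc]⟩

variable {I J : Type*} [Fintype I] [Fintype J]

lemma sum_inl_ι_coord_mul_iContrL (b : Module.Basis (I ⊕ J) ℝ V) {k : ℕ} {η : EForm V}
    (hη : η ∈ ⋀[ℝ]^k (Module.Dual ℝ V)) (h : ∀ j, iContrL (b (.inr j)) η = 0) :
    ∑ i, ι ℝ (b.coord (.inl i)) * iContrL (b (.inl i)) η = (k : ℝ) • η := by
  rw [← sum_ι_coord_mul_iContrL b hη, Fintype.sum_sum_type]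
  simp [h]

lemma isDecomposable3_sum_inl (b : Module.Basis (Fin 3 ⊕ J) ℝ V) {ω : EForm V}
    (hω : ω ∈ ⋀[ℝ]^3 (Module.Dual ℝ V))
    (h : ∀ i j, iContrL (b (.inr j)) (iContrL (b (.inl i)) ω) = 0) (r : ℝ) :
    IsDecomposable3 (r • ∑ i, ι ℝ (b.coord (.inl i)) * iContrL (b (.inl i)) ω) := by
  refine isDecomposable3_of_mem_span (a := fun i => b.coord (.inl i))
    (Submodule.smul_mem _ _ (Submodule.sum_mem _ fun i _ => ?_))
  have hi := iContrL_mem (b (.inl i)) hω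
  rw [← inv_smul_smul₀ (two_ne_zero' ℝ) (iContrL (b (.inl i)) ω)]
  have h2 := sum_inl_ι_coord_mul_iContrL b hi (h i)
  norm_num at h2
  rw [← h2, mul_smul_comm, Finset.mul_sum]
  refine Submodule.smul_mem _ _ (Submodule.sum_mem _ fun j _ => ?_)
  have hj := iContrL_mem (b (.inl j)) hi
  have h1 := sum_inl_ι_coord_mul_iContrL b hj fun k => by
    rw [iContrL_comm, h, map_zero, neg_zero]
  norm_num at h1
  rw [← h1, Finset.mul_sum, Finset.mul_sum]
  refine Submodule.sum_mem _ fun k _ => ?_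
  have hk := iContrL_mem (b (.inl k)) hj
  rw [exteriorPower, pow_zero, Submodule.mem_one] at hk
  obtain ⟨c, hc⟩ := hk
  rw [← hc, ← Algebra.commutes, ← Algebra.smul_def, mul_smul_comm, mul_smul_comm, ← mul_assoc]
  exact Submodule.smul_mem _ _ (ι_mul_ι_mul_ι_mem_span (fun i => b.coord (.inl i)) i j k)

lemma exists_isDecomposable3_add (b : Module.Basis (Fin 3 ⊕ Fin 3) ℝ V) {ω : EForm V}
    (hω : ω ∈ ⋀[ℝ]^3 (Module.Dual ℝ V))
    (h : ∀ i j, iContrL (b (.inl i)) (iContrL (b (.inr j)) ω) = 0) :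
    ∃ α β : EForm V, IsDecomposable3 α ∧ IsDecomposable3 β ∧ ω = α + β := by
  refine ⟨_, _, isDecomposable3_sum_inl b hω (fun i j => ?_) 3⁻¹,
    isDecomposable3_sum_inl (b.reindex (Equiv.sumComm _ _)) hω (fun i j => ?_) 3⁻¹, ?_⟩
  · rw [iContrL_comm, h, neg_zero]
  · simpa using h j i
  · have h3 := sum_ι_coord_mul_iContrL b hω
    rw [Fintype.sum_sum_type] at h3
    rw [← smul_add, eq_inv_smul_iff₀ (by norm_num)]
    have hcoord (x : Fin 3) : (b.reindex (Equiv.sumComm _ _)).coord (.inl x) =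
        b.coord (.inr x) := by
      ext
      simp only [Module.Basis.coord_apply, Module.Basis.repr_reindex_apply]
      rfl
    simpa [hcoord] using h3.symm

lemma IsDecomposable3.mem {α : EForm V} (hα : IsDecomposable3 α) :
    α ∈ ⋀[ℝ]^3 (Module.Dual ℝ V) := by
  obtain ⟨a, b, c, rfl⟩ := hα
  rw [exteriorPower, pow_succ, pow_two]
  exact Submodule.mul_mem_mul (Submodule.mul_mem_mul ⟨a, rfl⟩ ⟨b, rfl⟩) ⟨c, rfl⟩

lemma ι_mul_decomposable (a b c : Module.Dual ℝ V) :
    ι ℝ a * (ι ℝ a * ι ℝ b * ι ℝ c) = 0 ∧ ι ℝ b * (ι ℝ a * ι ℝ b * ι ℝ c) = 0 ∧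
      ι ℝ c * (ι ℝ a * ι ℝ b * ι ℝ c) = 0 := by
  have h (f g : Module.Dual ℝ V) : ι ℝ f * ι ℝ g = -(ι ℝ g * ι ℝ f) :=
    eq_neg_of_add_eq_zero_left (ι_add_mul_swap f g)
  refine ⟨?_, ?_, ?_⟩
  · simp [← mul_assoc]
  · rw [h a b]; simp [← mul_assoc]
  · rw [mul_assoc, h b c, mul_neg, ← mul_assoc, h a c]; simp [← mul_assoc]

lemma IsDecomposable3.iContrL_mul_self {α : EForm V} (hα : IsDecomposable3 α) (X : V) :
    iContrL X α * α = 0 := by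
  obtain ⟨a, b, c, rfl⟩ := hα
  obtain ⟨-, hb, hc⟩ := ι_mul_decomposable a b c
  rw [mul_assoc, iContrL_ι_mul, iContrL_ι_mul, iContrL_ι, ← mul_assoc (ι ℝ a), ← Algebra.commutes,
    ← Algebra.smul_def]
  simp [sub_mul, mul_sub, mul_assoc (ι ℝ _) _ (ι ℝ a * ι ℝ b * ι ℝ c), hb, hc]

/-- The annihilator of a decomposable summand `α` of `ω = α + β` consists of eigenvectors of the
transpose of the Hitchin endomorphism. -/
lemma IsDecomposable3.apply_hitchin {θ ω α β : EForm V}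
    (hθ : ∀ f : Module.Dual ℝ V, ι ℝ f * θ = 0) (hθ0 : θ ≠ 0) {K : V →ₗ[ℝ] V}
    (hK : ∀ X : V, iContrL X ω * ω = iContrL (K X) θ) (hα : IsDecomposable3 α)
    (hβ : IsDecomposable3 β) (hω : ω = α + β) {c : ℝ} (hc : α * β = c • θ)
    {f : Module.Dual ℝ V} (hf : ι ℝ f * α = 0) (X : V) : f (K X) = c * f X := by
  have h1 : ι ℝ f * iContrL X α = f X • α := by
    have h := iContrL_ι_mul X f α
    rw [hf, map_zero] at h
    exact (sub_eq_zero.mp h.symm).symm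
  have h2 : ι ℝ f * (iContrL X β * α) = 0 := by
    rw [mul_comm_of_mem hα.mem (iContrL_mem X hβ.mem), mul_smul_comm, ← mul_assoc, hf, zero_mul,
      smul_zero]
  have h := congrArg (ι ℝ f * ·) (hK X)
  simp only [hω, map_add, add_mul, mul_add, hα.iContrL_mul_self, hβ.iContrL_mul_self,
    ι_mul_iContrL_top hθ, h2, zero_add, add_zero] at h
  rw [← mul_assoc, h1, smul_mul_assoc, hc, smul_smul, mul_comm] at h
  exact (smul_left_injective ℝ hθ0 h).symm

lemma IsDecomposable3.formPullback_hitchin {θ ω α β : EForm V}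
    (hθ : ∀ f : Module.Dual ℝ V, ι ℝ f * θ = 0) (hθ0 : θ ≠ 0) {K : V →ₗ[ℝ] V}
    (hK : ∀ X : V, iContrL X ω * ω = iContrL (K X) θ) (hα : IsDecomposable3 α)
    (hβ : IsDecomposable3 β) (hω : ω = α + β) {c : ℝ} (hc : α * β = c • θ) :
    formPullback K α = c ^ 3 • α := by
  have h {f : Module.Dual ℝ V} (hf : ι ℝ f * α = 0) :
      formPullback K (ι ℝ f) = c • ι ℝ f := by
    rw [formPullback, ExteriorAlgebra.lift_ι_apply, LinearMap.comp_apply, ← map_smul]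
    congr 1
    ext X
    simpa using hα.apply_hitchin hθ hθ0 hK hβ hω hc hf X
  obtain ⟨p, q, r, hpqr⟩ := hα
  obtain ⟨hp, hq, hr⟩ := ι_mul_decomposable p q r
  rw [← hpqr] at hp hq hr
  rw [hpqr, map_mul, map_mul, h hp, h hq, h hr]
  simp only [smul_mul_assoc, mul_smul_comm, smul_smul]
  ring_nf

lemma IsDecomposable3.hitchin_sq {θ ω α β : EForm V}
    (hθ : ∀ f : Module.Dual ℝ V, ι ℝ f * θ = 0) (hθ0 : θ ≠ 0) {K : V →ₗ[ℝ] V}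
    (hK : ∀ X : V, iContrL X ω * ω = iContrL (K X) θ) (hα : IsDecomposable3 α)
    (hβ : IsDecomposable3 β) (hω : ω = α + β) {c : ℝ} (hc0 : c ≠ 0) (hc : α * β = c • θ)
    {l : ℝ} (hl : ∀ X, K (K X) = l • X) : l = c ^ 2 := by
  obtain ⟨p, q, r, hpqr⟩ := id hα
  obtain ⟨X, hX⟩ : ∃ X, p X ≠ 0 := by
    by_contra! h
    rw [hpqr, (LinearMap.ext h : p = 0), map_zero, zero_mul, zero_mul, zero_mul] at hc
    exact smul_ne_zero hc0 hθ0 hc.symm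
  have hp := (ι_mul_decomposable p q r).1
  rw [← hpqr] at hp
  have h := hα.apply_hitchin hθ hθ0 hK hβ hω hc hp
  have hKK := h (K X)
  rw [hl, h, map_smul, smul_eq_mul, ← mul_assoc, ← pow_two] at hKK
  exact mul_right_cancel₀ hX hKK

end Decomposable

/-- Hitchin: if `λ(ω) > 0` then `ω = α + β` with `α, β` real decomposable 3-forms;
moreover, under the normalization `(α ∧ β)/θ > 0` the decomposition is unique, given by
`2α = ω + |λ(ω)|^{-3/2} K_ω^*(ω)` and `2β = ω - |λ(ω)|^{-3/2} K_ω^*(ω)`. -/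
theorem hitchin_decomposition_pos [FiniteDimensional ℝ V]
    (hdim : Module.finrank ℝ V = 6)
    (θ : EForm V) (hθ : θ ∈ ⋀[ℝ]^6 (Module.Dual ℝ V)) (hθ0 : θ ≠ 0)
    (ω : EForm V) (hω : ω ∈ ⋀[ℝ]^3 (Module.Dual ℝ V))
    (K : V →ₗ[ℝ] V)
    (hK : ∀ X : V, (iContrL X ω) * ω = iContrL (K X) θ)
    (hlam : 0 < (1/6 : ℝ) * LinearMap.trace ℝ V (K ∘ₗ K)) :
    (∃ α β : EForm V, IsDecomposable3 α ∧ IsDecomposable3 β ∧ ω = α + β) ∧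
    (∀ α β : EForm V, IsDecomposable3 α → IsDecomposable3 β → ω = α + β →
      (∃ c : ℝ, 0 < c ∧ α * β = c • θ) →
      (2 : ℝ) • α = ω + (|(1/6 : ℝ) * LinearMap.trace ℝ V (K ∘ₗ K)| ^ (-(3 : ℝ)/2)) •
          formPullback K ω ∧
      (2 : ℝ) • β = ω - (|(1/6 : ℝ) * LinearMap.trace ℝ V (K ∘ₗ K)| ^ (-(3 : ℝ)/2)) •
          formPullback K ω) := by
  have hθf := ι_mul_eq_zero_of_top hdim hθ
  obtain ⟨l, hl⟩ := exists_hitchin_sq hθf hθ0 hω hK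
  have htr : (1/6 : ℝ) * LinearMap.trace ℝ V (K ∘ₗ K) = l := by
    rw [show K ∘ₗ K = l • LinearMap.id from LinearMap.ext hl, map_smul, LinearMap.trace_id, hdim,
      smul_eq_mul]
    push_cast
    ring
  rw [htr] at hlam ⊢
  constructor
  · have hs := (Real.sqrt_pos.mpr hlam).ne'
    obtain ⟨b, hb₁, hb₂⟩ := exists_eigenbasis_of_sq (n := 3) hdim
      (trace_hitchin hθf hθ0 hω hK) hs fun X => by rw [Real.sq_sqrt hlam.le, hl]
    exact exists_isDecomposable3_add b hω fun i j =>
      iContrL_iContrL_of_eigen hθf hθ0 hω hK hs (hb₁ i) (hb₂ j)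
  · rintro α β hα hβ hαβ ⟨c, hc, hcθ⟩
    have hcθ' : β * α = (-c) • θ := by
      rw [mul_comm_of_mem hα.mem hβ.mem, hcθ]
      norm_num
    have hKα := hα.formPullback_hitchin hθf hθ0 hK hβ hαβ hcθ
    have hKβ := hβ.formPullback_hitchin hθf hθ0 hK hα (hαβ.trans (add_comm _ _)) hcθ'
    have hpow : |l| ^ (-(3 : ℝ) / 2) = (c ^ 3)⁻¹ := by
      rw [abs_of_pos hlam, hα.hitchin_sq hθf hθ0 hK hβ hαβ hc.ne' hcθ hl, ← Real.rpow_natCast c 2,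
        ← Real.rpow_mul hc.le, ← Real.rpow_natCast c 3, ← Real.rpow_neg hc.le]
      norm_num
    have hscale : (c ^ 3)⁻¹ • formPullback K ω = α - β := by
      rw [hαβ, map_add, hKα, hKβ, smul_add, Odd.neg_pow (by decide), neg_smul, smul_neg,
        inv_smul_smul₀ (by positivity), inv_smul_smul₀ (by positivity), sub_eq_add_neg]
    rw [hpow, hscale, hαβ, two_smul, two_smul]
    constructor <;> abel
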